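/- Assume the COLD setup for some k ≥ 1, fix subsets S, S̄ ⊆ {1,…,k}, and let E split X into sets of size 4. Then there exists a random variable U, adjoinable to all the given variables, that is uniform over a 105-element set and satisfies I(U; (E, V_S, V̄_S̄)) = 0 and H(F | V_S, V̄_S̄, E, U) = 0, if and only if a_e ≤ 3 for every e with P(E=e) > 0. -/

import Mathlib

namespace CIPaper

/-- A bundled probability space. -/
structure ProbSpace where
  carrier : Type
  [inst : MeasurableSpace carrier]
  μ : MeasureTheory.Measure carrier
  [isProb : MeasureTheory.IsProbabilityMeasure μ]

attribute [instance] ProbSpace.inst ProbSpace.isProb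

/-- A bundled finite measurable alphabet, used as value space of auxiliary random variables. -/
structure FinAlphabet where
  carrier : Type
  [fin : Fintype carrier]
  [ms : MeasurableSpace carrier]
  [msc : MeasurableSingletonClass carrier]

attribute [instance] FinAlphabet.fin FinAlphabet.ms FinAlphabet.msc

open MeasureTheory ProbabilityTheory Real

variable {Ω : Type*} [MeasurableSpace Ω] {S T U : Type*}

/-- P(X = x). -/
noncomputable def pr (μ : Measure Ω) (X : Ω → S) (x : S) : ℝ :=
  (μ (X ⁻¹' {x})).toReal

/-- Shannon entropy (base 2) of a finite-valued random variable. -/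
noncomputable def ent (μ : Measure Ω) [Fintype S] (X : Ω → S) : ℝ :=
  (∑ x, Real.negMulLog (pr μ X x)) / Real.log 2

/-- Conditional entropy H(X|Y). -/
noncomputable def condEnt (μ : Measure Ω) [Fintype S] [Fintype T]
    (X : Ω → S) (Y : Ω → T) : ℝ :=
  ent μ (fun ω => (X ω, Y ω)) - ent μ Y

/-- Mutual information I(X;Y). -/
noncomputable def mi (μ : Measure Ω) [Fintype S] [Fintype T]
    (X : Ω → S) (Y : Ω → T) : ℝ :=
  ent μ X + ent μ Y - ent μ (fun ω => (X ω, Y ω))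

/-- Conditional mutual information I(X;Y|Z). -/
noncomputable def cmi (μ : Measure Ω) [Fintype S] [Fintype T] [Fintype U]
    (X : Ω → S) (Y : Ω → T) (Z : Ω → U) : ℝ :=
  ent μ (fun ω => (X ω, Z ω)) + ent μ (fun ω => (Y ω, Z ω))
    - ent μ (fun ω => (X ω, (Y ω, Z ω))) - ent μ Z

/-- The support of a random variable: values of positive probability. -/
def support (μ : Measure Ω) (X : Ω → S) : Set S := {x | 0 < pr μ X x}

/-- X is uniformly distributed over its support. -/
def IsUniform (μ : Measure Ω) (X : Ω → S) : Prop :=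
  ∀ x ∈ support μ X, ∀ y ∈ support μ X, pr μ X x = pr μ X y

/-- X is uniformly distributed over a support of size n. -/
def UniformOn (μ : Measure Ω) (X : Ω → S) (n : ℕ) : Prop :=
  IsUniform μ X ∧ (support μ X).ncard = n

/-- The TRIPLE predicate: pairwise independence plus each variable a function of the
other two. -/
def TRIPLE (μ : Measure Ω) [Fintype S] [Fintype T] [Fintype U]
    (X : Ω → S) (Y : Ω → T) (Z : Ω → U) : Prop :=
  condEnt μ X (fun ω => (Y ω, Z ω)) = 0 ∧ condEnt μ Y (fun ω => (X ω, Z ω)) = 0 ∧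
    condEnt μ Z (fun ω => (X ω, Y ω)) = 0 ∧
    mi μ X Y = 0 ∧ mi μ X Z = 0 ∧ mi μ Y Z = 0

end CIPaper

namespace CIPaper

open MeasureTheory ProbabilityTheory Real

/-- E splits X into sets of size l: E is a function of X and, conditioned on any value e
of positive probability, X is uniform over exactly l values. -/
def Splits {Ω : Type*} [MeasurableSpace Ω] (μ : Measure Ω) {SX SE : Type*}
    [Fintype SX] [Fintype SE] (X : Ω → SX) (E : Ω → SE) (l : ℕ) : Prop :=
  condEnt μ E X = 0 ∧
  ∀ e : SE, 0 < pr μ E e →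
    (∀ x : SX, pr μ (fun ω => (X ω, E ω)) (x, e) = 0 ∨
        pr μ (fun ω => (X ω, E ω)) (x, e) = pr μ E e / l) ∧
    Set.ncard {x : SX | 0 < pr μ (fun ω => (X ω, E ω)) (x, e)} = l

/-- a_e: the number of values x of X compatible with E = e whose label w(x) satisfies
sat(w(x), S, S̄) = 1. -/
noncomputable def aCount {Ω : Type*} [MeasurableSpace Ω] (μ : Measure Ω) {SX SE : Type*}
    (k : ℕ) (X : Ω → SX) (E : Ω → SE) (wfun : SX → (Fin k → Fin 2))
    (S Sb : Finset (Fin k)) (e : SE) : ℕ :=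
  Set.ncard {x : SX | 0 < pr μ (fun ω => (X ω, E ω)) (x, e) ∧
    (∀ i ∈ S, wfun x i = 1) ∧ ∀ i ∈ Sb, wfun x i = 0}

section Entropy

variable {Ω : Type*} [MeasurableSpace Ω] {A B C : Type*}

lemma pr_nonneg (μ : Measure Ω) (X : Ω → A) (x : A) : 0 ≤ pr μ X x := ENNReal.toReal_nonneg

lemma pr_mono (μ : Measure Ω) [IsFiniteMeasure μ] {X : Ω → A} {Y : Ω → B} {x : A} {y : B}
    (h : ∀ ω, X ω = x → Y ω = y) : pr μ X x ≤ pr μ Y y :=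
  measureReal_mono (μ := μ) (fun ω hω => h ω hω)

lemma measureReal_eq_sum_inter (μ : Measure Ω) [IsFiniteMeasure μ] [Fintype B]
    [MeasurableSpace B] [MeasurableSingletonClass B] {Y : Ω → B}
    (hY : Measurable Y) (s : Set Ω) : μ.real s = ∑ y, μ.real (s ∩ Y ⁻¹' {y}) := by
  have h := sum_measureReal_preimage_singleton (μ := μ.restrict s) (f := Y) Finset.univ
    (fun y _ => hY (measurableSet_singleton y))
  simp only [Finset.coe_univ, Set.preimage_univ] at h
  rw [measureReal_restrict_apply MeasurableSet.univ, Set.univ_inter] at h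
  rw [← h]
  refine Finset.sum_congr rfl fun y _ => ?_
  rw [measureReal_restrict_apply (hY (measurableSet_singleton y)), Set.inter_comm]

lemma pr_eq_sum_left (μ : Measure Ω) [IsFiniteMeasure μ] [Fintype A] [MeasurableSpace A]
    [MeasurableSingletonClass A] {X : Ω → A} (hX : Measurable X)
    (Y : Ω → B) (y : B) : pr μ Y y = ∑ x, pr μ (fun ω => (X ω, Y ω)) (x, y) := by
  rw [pr, ← Measure.real, measureReal_eq_sum_inter μ hX]
  refine Finset.sum_congr rfl fun x _ => ?_
  rw [pr, ← Measure.real]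
  congr 1
  ext ω
  simp [and_comm]

lemma pr_eq_sum_right (μ : Measure Ω) [IsFiniteMeasure μ] [Fintype B] [MeasurableSpace B]
    [MeasurableSingletonClass B] (X : Ω → A) {Y : Ω → B}
    (hY : Measurable Y) (x : A) : pr μ X x = ∑ y, pr μ (fun ω => (X ω, Y ω)) (x, y) := by
  rw [pr, ← Measure.real, measureReal_eq_sum_inter μ hY]
  refine Finset.sum_congr rfl fun y _ => ?_
  rw [pr, ← Measure.real]
  congr 1
  ext ω
  simp

lemma sum_pr (μ : Measure Ω) [IsProbabilityMeasure μ] [Fintype A]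
    [MeasurableSpace A] [MeasurableSingletonClass A] {X : Ω → A} (hX : Measurable X) :
    ∑ x, pr μ X x = 1 := by
  have h := measureReal_eq_sum_inter μ hX Set.univ
  simp only [Set.univ_inter, probReal_univ] at h
  exact h.symm

lemma log_two_ne_zero : Real.log 2 ≠ 0 := (Real.log_pos one_lt_two).ne'

variable [Fintype A] [MeasurableSpace A] [MeasurableSingletonClass A] [Fintype B]

/-- Conditional entropy vanishes iff the first variable is a function of the second. -/
lemma condEnt_eq_zero_iff (μ : Measure Ω) [IsFiniteMeasure μ] {X : Ω → A} {Y : Ω → B}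
    (hX : Measurable X) :
    condEnt μ X Y = 0 ↔ ∀ x y, pr μ (fun ω => (X ω, Y ω)) (x, y) = 0 ∨
      pr μ (fun ω => (X ω, Y ω)) (x, y) = pr μ Y y := by
  set p := pr μ (fun ω => (X ω, Y ω)) with hp
  set q := pr μ Y with hq
  have hpq : ∀ z, p z ≤ q z.2 := fun z => pr_mono μ fun ω h => by rw [← h]
  have hp0 : ∀ z, 0 ≤ p z := pr_nonneg μ _
  have key : condEnt μ X Y = (∑ z : A × B, p z * (Real.log (q z.2) - Real.log (p z))) /
      Real.log 2 := by
    have h1 : ∑ y, Real.negMulLog (q y) = ∑ z : A × B, -(p z * Real.log (q z.2)) := by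
      rw [Fintype.sum_prod_type_right]
      refine Finset.sum_congr rfl fun y _ => ?_
      dsimp only
      rw [Finset.sum_neg_distrib, ← Finset.sum_mul, ← pr_eq_sum_left μ hX Y y, Real.negMulLog,
        neg_mul]
    rw [condEnt, ent, ent, ← sub_div, ← hp, ← hq, h1, ← Finset.sum_sub_distrib]
    congr 1
    refine Finset.sum_congr rfl fun z _ => ?_
    rw [Real.negMulLog]; ring
  have hterm : ∀ z, 0 ≤ p z * (Real.log (q z.2) - Real.log (p z)) := fun z => by
    rcases (hp0 z).eq_or_lt with h | h
    · simp [← h]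
    · exact mul_nonneg h.le (sub_nonneg.2 (Real.log_le_log h (hpq z)))
  rw [key, div_eq_zero_iff, or_iff_left log_two_ne_zero,
    Finset.sum_eq_zero_iff_of_nonneg (fun z _ => hterm z)]
  constructor
  · intro h x y
    rcases (hp0 (x, y)).eq_or_lt with h0 | h0
    · exact Or.inl h0.symm
    · right
      rcases mul_eq_zero.1 (h (x, y) (Finset.mem_univ _)) with h1 | h1
      · exact absurd h1 h0.ne'
      · exact (Real.log_injOn_pos (h0.trans_le (hpq _)) h0 (sub_eq_zero.1 h1)).symm
  · rintro h ⟨x, y⟩ -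
    rcases h x y with h | h <;> simp [h]

lemma condEnt_eq_zero_of_forall_exists (μ : Measure Ω) [IsFiniteMeasure μ] {X : Ω → A}
    {Y : Ω → B} (hX : Measurable X)
    (h : ∀ y, ∃ x₀, ∀ x, x ≠ x₀ → pr μ (fun ω => (X ω, Y ω)) (x, y) = 0) :
    condEnt μ X Y = 0 := by
  rw [condEnt_eq_zero_iff μ hX]
  intro x y
  obtain ⟨x₀, hx₀⟩ := h y
  by_cases hx : x = x₀
  · right
    rw [pr_eq_sum_left μ hX Y y]
    refine (Fintype.sum_eq_single x fun x' hx' => hx₀ x' (hx ▸ hx')).symm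
  · exact Or.inl (hx₀ x hx)

/-- The equality case of Gibbs' inequality. -/
lemma eq_of_sum_mul_log_sub_log_eq_zero {ι : Type*} [Fintype ι] {p q : ι → ℝ}
    (hp : ∀ i, 0 ≤ p i) (hq : ∀ i, 0 ≤ q i) (hsum : ∑ i, q i ≤ ∑ i, p i)
    (habs : ∀ i, q i = 0 → p i = 0)
    (h : ∑ i, p i * (Real.log (p i) - Real.log (q i)) = 0) : ∀ i, p i = q i := by
  have hterm : ∀ i, p i ≠ q i →
      0 < p i * (Real.log (p i) - Real.log (q i)) - p i + q i := fun i hne => by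
    have hq' : 0 < q i := (hq i).lt_of_ne fun h0 => hne (by rw [habs i h0.symm, ← h0])
    rcases (hp i).eq_or_lt with h0 | h0
    · simpa [← h0] using hq'
    · have h1 := Real.log_lt_sub_one_of_pos (div_pos hq' h0)
        (fun h1 => hne ((div_eq_one_iff_eq h0.ne').1 h1).symm)
      rw [Real.log_div hq'.ne' h0.ne'] at h1
      have h2 := mul_lt_mul_of_pos_left h1 h0
      have h3 : p i * (q i / p i - 1) = q i - p i := by field_simp
      linarith
  have hterm' : ∀ i, 0 ≤ p i * (Real.log (p i) - Real.log (q i)) - p i + q i := fun i => by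
    by_cases hne : p i = q i
    · simp [hne]
    · exact (hterm i hne).le
  have hs : ∑ i, (p i * (Real.log (p i) - Real.log (q i)) - p i + q i) = 0 := by
    refine le_antisymm ?_ (Finset.sum_nonneg fun i _ => hterm' i)
    rw [Finset.sum_add_distrib, Finset.sum_sub_distrib, h]
    linarith
  intro i
  by_contra hne
  exact (hterm i hne).ne'
    ((Finset.sum_eq_zero_iff_of_nonneg fun i _ => hterm' i).1 hs i (Finset.mem_univ i))

variable [MeasurableSpace B] [MeasurableSingletonClass B]
  [Fintype C] [MeasurableSpace C] [MeasurableSingletonClass C]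

/-- Mutual information vanishes iff the joint law is the product of the marginals. -/
lemma mi_eq_zero_iff (μ : Measure Ω) [IsProbabilityMeasure μ] {X : Ω → A} {Y : Ω → B}
    (hX : Measurable X) (hY : Measurable Y) :
    mi μ X Y = 0 ↔ ∀ x y, pr μ (fun ω => (X ω, Y ω)) (x, y) = pr μ X x * pr μ Y y := by
  set p := pr μ (fun ω => (X ω, Y ω)) with hp
  set a := pr μ X with ha
  set b := pr μ Y with hb
  have hpa : ∀ z, p z ≤ a z.1 := fun z => pr_mono μ fun ω h => by rw [← h]
  have hpb : ∀ z, p z ≤ b z.2 := fun z => pr_mono μ fun ω h => by rw [← h]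
  have hp0 : ∀ z, 0 ≤ p z := pr_nonneg μ _
  have ha0 : ∀ x, 0 ≤ a x := pr_nonneg μ _
  have hb0 : ∀ x, 0 ≤ b x := pr_nonneg μ _
  have hterm : ∀ z, p z * (Real.log (p z) - Real.log (a z.1 * b z.2)) =
      p z * (Real.log (p z) - Real.log (a z.1) - Real.log (b z.2)) := fun z => by
    rcases (hp0 z).eq_or_lt with h | h
    · simp [← h]
    · rw [Real.log_mul (h.trans_le (hpa z)).ne' (h.trans_le (hpb z)).ne']; ring
  have key : mi μ X Y = (∑ z : A × B, p z * (Real.log (p z) - Real.log (a z.1 * b z.2))) /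
      Real.log 2 := by
    have h1 : ∑ y, Real.negMulLog (b y) = ∑ z : A × B, -(p z * Real.log (b z.2)) := by
      rw [Fintype.sum_prod_type_right]
      refine Finset.sum_congr rfl fun y _ => ?_
      dsimp only
      rw [Finset.sum_neg_distrib, ← Finset.sum_mul, ← pr_eq_sum_left μ hX Y y, Real.negMulLog,
        neg_mul]
    have h2 : ∑ y, Real.negMulLog (a y) = ∑ z : A × B, -(p z * Real.log (a z.1)) := by
      rw [Fintype.sum_prod_type]
      refine Finset.sum_congr rfl fun y _ => ?_
      dsimp only
      rw [Finset.sum_neg_distrib, ← Finset.sum_mul, ← pr_eq_sum_right μ X hY y, Real.negMulLog,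
        neg_mul]
    rw [mi, ent, ent, ent, ← add_div, ← sub_div, ← hp, ← ha, ← hb, h1, h2,
      ← Finset.sum_add_distrib, ← Finset.sum_sub_distrib]
    congr 1
    refine Finset.sum_congr rfl fun z _ => ?_
    rw [hterm, Real.negMulLog]; ring
  rw [key, div_eq_zero_iff, or_iff_left log_two_ne_zero]
  constructor
  · intro h x y
    refine eq_of_sum_mul_log_sub_log_eq_zero (q := fun z : A × B => a z.1 * b z.2) hp0
      (fun z => mul_nonneg (ha0 _) (hb0 _)) ?_ ?_ h (x, y)
    · rw [Fintype.sum_prod_type, ← Fintype.sum_mul_sum, sum_pr μ hX, sum_pr μ hY,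
        sum_pr μ (hX.prodMk hY), one_mul]
    · intro z hz
      rcases mul_eq_zero.1 hz with h0 | h0
      · exact le_antisymm (h0 ▸ hpa z) (hp0 z)
      · exact le_antisymm (h0 ▸ hpb z) (hp0 z)
  · intro h
    refine Finset.sum_eq_zero fun z _ => ?_
    rw [← h z.1 z.2, sub_self, mul_zero]

/-- Vanishing conditional mutual information yields conditional independence. -/
lemma pr_mul_pr_eq_of_cmi_eq_zero (μ : Measure Ω) [IsProbabilityMeasure μ] {X : Ω → A}
    {Y : Ω → B} {Z : Ω → C} (hX : Measurable X) (hY : Measurable Y) (hZ : Measurable Z)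
    (h : cmi μ X Y Z = 0) (x : A) (y : B) (z : C) :
    pr μ (fun ω => (X ω, (Y ω, Z ω))) (x, (y, z)) * pr μ Z z =
      pr μ (fun ω => (X ω, Z ω)) (x, z) * pr μ (fun ω => (Y ω, Z ω)) (y, z) := by
  set p := pr μ (fun ω => (X ω, (Y ω, Z ω))) with hp
  set a := pr μ (fun ω => (X ω, Z ω)) with ha
  set b := pr μ (fun ω => (Y ω, Z ω)) with hb
  set c := pr μ Z with hc
  have hpa : ∀ t, p t ≤ a (t.1, t.2.2) := fun t => pr_mono μ fun ω h => by rw [← h]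
  have hpb : ∀ t, p t ≤ b t.2 := fun t => pr_mono μ fun ω h => by rw [← h]
  have hpc : ∀ t, p t ≤ c t.2.2 := fun t => pr_mono μ fun ω h => by rw [← h]
  have hp0 : ∀ t, 0 ≤ p t := pr_nonneg μ _
  have ha0 : ∀ t, 0 ≤ a t := pr_nonneg μ _
  have hb0 : ∀ t, 0 ≤ b t := pr_nonneg μ _
  have hc0 : ∀ t, 0 ≤ c t := pr_nonneg μ _
  have sa : ∀ x z, a (x, z) = ∑ y, p (x, (y, z)) := fun x z => by
    rw [ha, pr_eq_sum_left μ hY]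
    refine Finset.sum_congr rfl fun y _ => ?_
    simp only [hp, pr]
    congr 2
    ext ω
    simp only [Set.mem_preimage, Set.mem_singleton_iff, Prod.mk.injEq]
    tauto
  have sb : ∀ t, b t = ∑ x, p (x, t) := fun t => pr_eq_sum_left μ hX _ t
  have sca : ∀ z, c z = ∑ x, a (x, z) := fun z => pr_eq_sum_left μ hX _ z
  have scb : ∀ z, c z = ∑ y, b (y, z) := fun z => pr_eq_sum_left μ hY _ z
  set q : A × B × C → ℝ := fun t => a (t.1, t.2.2) * b t.2 / c t.2.2 with hq
  have hqs : ∑ t, q t = ∑ t, p t := by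
    rw [sum_pr μ (hX.prodMk (hY.prodMk hZ)), Fintype.sum_prod_type_right,
      Fintype.sum_prod_type_right, ← sum_pr μ hZ]
    refine Finset.sum_congr rfl fun z _ => ?_
    simp only [hq]
    have : ∀ y, ∑ x, a (x, z) * b (y, z) / c z = c z / c z * b (y, z) := fun y => by
      rw [← Finset.sum_div, ← Finset.sum_mul, ← sca]; ring
    rw [Finset.sum_congr rfl fun y _ => this y, ← Finset.mul_sum, ← scb, div_mul_cancel_of_imp]
    exact id
  have hq0 : ∀ t, 0 ≤ q t := fun t => div_nonneg (mul_nonneg (ha0 _) (hb0 _)) (hc0 _)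
  have habs : ∀ t, q t = 0 → p t = 0 := fun t ht => by
    by_contra hne
    have hpos := (hp0 t).lt_of_ne' hne
    exact (div_pos (mul_pos (hpos.trans_le (hpa t)) (hpos.trans_le (hpb t)))
      (hpos.trans_le (hpc t))).ne' ht
  have h1 : ∑ t, Real.negMulLog (a t) = ∑ t, -(p t * Real.log (a (t.1, t.2.2))) := by
    rw [Fintype.sum_prod_type, Fintype.sum_prod_type]
    refine Finset.sum_congr rfl fun x _ => ?_
    rw [Fintype.sum_prod_type_right]
    refine Finset.sum_congr rfl fun z _ => ?_
    dsimp only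
    rw [Finset.sum_neg_distrib, ← Finset.sum_mul, ← sa, Real.negMulLog, neg_mul]
  have h2 : ∑ t, Real.negMulLog (b t) = ∑ t, -(p t * Real.log (b t.2)) := by
    rw [Fintype.sum_prod_type_right (f := fun t => -(p t * Real.log (b t.2)))]
    refine Finset.sum_congr rfl fun t _ => ?_
    dsimp only
    rw [Finset.sum_neg_distrib, ← Finset.sum_mul, ← sb, Real.negMulLog, neg_mul]
  have h3 : ∑ z, Real.negMulLog (c z) = ∑ t, -(p t * Real.log (c t.2.2)) := by
    rw [Fintype.sum_prod_type_right, Fintype.sum_prod_type_right]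
    refine Finset.sum_congr rfl fun z _ => ?_
    simp only [Finset.sum_neg_distrib, ← Finset.sum_mul, ← sb, ← scb]
    rw [Real.negMulLog, neg_mul]
  have key : ∑ t, p t * (Real.log (p t) - Real.log (q t)) = 0 := by
    rw [cmi, ent, ent, ent, ent, ← add_div, ← sub_div, ← sub_div, div_eq_zero_iff,
      or_iff_left log_two_ne_zero, ← hp, ← ha, ← hb, ← hc, h1, h2, h3, ← Finset.sum_add_distrib,
      ← Finset.sum_sub_distrib, ← Finset.sum_sub_distrib] at h
    rw [← h]
    refine Finset.sum_congr rfl fun t _ => ?_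
    rcases (hp0 t).eq_or_lt with h | h
    · simp [← h]
    · have hA := (h.trans_le (hpa t)).ne'
      have hB := (h.trans_le (hpb t)).ne'
      rw [hq, Real.log_div (mul_ne_zero hA hB) (h.trans_le (hpc t)).ne', Real.log_mul hA hB,
        Real.negMulLog]
      ring
  have := eq_of_sum_mul_log_sub_log_eq_zero hp0 hq0 hqs.le habs key (x, (y, z))
  rw [this]
  refine div_mul_cancel_of_imp fun h0 => ?_
  have : a (x, z) = 0 := le_antisymm (h0 ▸ pr_mono μ fun ω h => by
    simpa using (congrArg Prod.snd h)) (ha0 _)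
  rw [this, zero_mul]

end Entropy

section Setup

variable {k : ℕ}

/-- The satisfaction predicate `sat(w, S, S̄) = 1`. -/
def IsSat (S Sb : Finset (Fin k)) (w : Fin k → Fin 2) : Prop :=
  (∀ i ∈ S, w i = 1) ∧ ∀ i ∈ Sb, w i = 0

/-- The value of the pair `(V_S, V̄_S̄)` as a function of `F` and `W`. -/
def label (S Sb : Finset (Fin k)) (f : Fin 2) (w : Fin k → Fin 2) :
    (S → Fin 2) × (Sb → Fin 2) :=
  (fun i => (1 - w i.1) * f, fun i => w i.1 * f)

lemma label_eq_zero_iff (S Sb : Finset (Fin k)) (f : Fin 2) (w : Fin k → Fin 2) :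
    label S Sb f w = 0 ↔ f = 0 ∨ IsSat S Sb w := by
  have h1 : ∀ a : Fin 2, (1 - a) * 1 = 0 ↔ a = 1 := by decide
  have h2 : ∀ a : Fin 2, a * 1 = 0 ↔ a = 0 := by decide
  rcases (by decide : ∀ f : Fin 2, f = 0 ∨ f = 1) f with rfl | rfl
  · simp [label, Prod.ext_iff, funext_iff]
  · simp only [label, IsSat, Prod.ext_iff, funext_iff, Prod.fst_zero, Prod.snd_zero,
      Pi.zero_apply, h1, h2, Subtype.forall, one_ne_zero, false_or]

variable {Ω : Type*} [MeasurableSpace Ω] {μ : Measure Ω} [IsProbabilityMeasure μ]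
  {F : Ω → Fin 2} {W : Ω → (Fin k → Fin 2)}
  {SX SE : Type*} [Fintype SX] [Fintype SE] [MeasurableSpace SX] [MeasurableSingletonClass SX]
  {X : Ω → SX} {E : Ω → SE} {wfun : SX → (Fin k → Fin 2)}

/-- In the COLD setup `F` is a fair coin independent of `X`. -/
lemma pr_coin_prod {V Vb : Fin k → Ω → Fin 2} (hFm : Measurable F) (hWm : Measurable W)
    (hXm : Measurable X)
    (hFunif : ∀ x : Fin 2, pr μ F x = 2⁻¹) (hindep : IndepFun F W μ)
    (hV : ∀ i ω, V i ω = (1 - W ω i) * F ω) (hVb : ∀ i ω, Vb i ω = W ω i * F ω)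
    (hw : ∀ᵐ ω ∂μ, W ω = wfun (X ω))
    (hcmi : cmi μ (fun ω => ((fun i => V i ω), (fun i => Vb i ω), F ω)) X W = 0)
    (f : Fin 2) (x : SX) : pr μ (fun ω => (F ω, X ω)) (f, x) = pr μ X x / 2 := by
  obtain rfl : V = fun i ω => (1 - W ω i) * F ω := funext₂ hV
  obtain rfl : Vb = fun i ω => W ω i * F ω := funext₂ hVb
  set w := wfun x
  have hm : Measurable fun ω => ((fun i => (1 - W ω i) * F ω), (fun i => W ω i * F ω), F ω) :=
    (Measurable.of_discrete (f := fun p : Fin 2 × (Fin k → Fin 2) =>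
      ((fun i => (1 - p.2 i) * p.1), (fun i => p.2 i * p.1), p.1))).comp (hFm.prodMk hWm)
  have h := pr_mul_pr_eq_of_cmi_eq_zero μ hm hXm hWm hcmi
    ((fun i => (1 - w i) * f), (fun i => w i * f), f) x w
  have e1 : pr μ (fun ω => (((fun i => (1 - W ω i) * F ω), (fun i => W ω i * F ω), F ω),
      (X ω, W ω))) (((fun i => (1 - w i) * f), (fun i => w i * f), f), (x, w)) =
      pr μ (fun ω => (F ω, X ω)) (f, x) := by
    refine congrArg ENNReal.toReal (measure_congr ?_)
    filter_upwards [hw] with ω hω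
    refine propext ⟨fun h => ?_, fun h => ?_⟩
    · have h' := Prod.ext_iff.1 h
      exact Prod.ext (congrArg (fun t => t.2.2) h'.1) (congrArg Prod.fst h'.2)
    · obtain ⟨h1, h2⟩ := Prod.ext_iff.1 h
      change F ω = f at h1
      change X ω = x at h2
      rw [h2] at hω
      change (_, _) = _
      rw [hω, h1, h2]
  have e2 : pr μ (fun ω => (((fun i => (1 - W ω i) * F ω), (fun i => W ω i * F ω), F ω),
      W ω)) (((fun i => (1 - w i) * f), (fun i => w i * f), f), w) = pr μ W w / 2 := by
    have : (fun ω => (((fun i => (1 - W ω i) * F ω), (fun i => W ω i * F ω), F ω),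
      W ω)) ⁻¹' {(((fun i => (1 - w i) * f), (fun i => w i * f), f), w)} =
        F ⁻¹' {f} ∩ W ⁻¹' {w} := by
      ext ω
      simp only [Set.mem_preimage, Set.mem_singleton_iff, Set.mem_inter_iff, Prod.mk.injEq]
      constructor
      · rintro ⟨⟨-, -, h1⟩, h2⟩
        exact ⟨h1, h2⟩
      · rintro ⟨rfl, h2⟩
        simp [h2]
    rw [pr, this, hindep.measure_inter_preimage_eq_mul _ _ (measurableSet_singleton _)
      (measurableSet_singleton _), ENNReal.toReal_mul]
    change pr μ F f * pr μ W w = _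
    rw [hFunif]; ring
  have e3 : pr μ (fun ω => (X ω, W ω)) (x, w) = pr μ X x := by
    refine congrArg ENNReal.toReal (measure_congr ?_)
    filter_upwards [hw] with ω hω
    refine propext ⟨fun h => congrArg Prod.fst h, fun h => ?_⟩
    change X ω = x at h
    change (_, _) = _
    rw [hω, h]
  rw [e1, e2, e3] at h
  rcases eq_or_ne (pr μ W w) 0 with h0 | h0
  · have hx : pr μ X x = 0 := le_antisymm (by
      rw [← h0, ← e3]
      exact pr_mono μ fun ω h => congrArg Prod.snd h) (pr_nonneg _ _ _)
    rw [hx, zero_div]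
    refine le_antisymm ?_ (pr_nonneg _ _ _)
    rw [← hx]
    exact pr_mono μ fun ω h => congrArg Prod.snd h
  · apply mul_right_cancel₀ h0
    rw [h]; ring

lemma pr_coin_prod_prod [MeasurableSpace SE] [MeasurableSingletonClass SE] (hXm : Measurable X)
    (hEm : Measurable E)
    (hFX : ∀ f x, pr μ (fun ω => (F ω, X ω)) (f, x) = pr μ X x / 2)
    (hE : condEnt μ E X = 0) (f : Fin 2) (x : SX) (e : SE) :
    pr μ (fun ω => (F ω, X ω, E ω)) (f, x, e) = pr μ (fun ω => (X ω, E ω)) (x, e) / 2 := by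
  have hs : pr μ (fun ω => (E ω, X ω)) (e, x) = pr μ (fun ω => (X ω, E ω)) (x, e) := by
    simp only [pr]
    congr 2
    ext ω
    simp [and_comm]
  have hle : pr μ (fun ω => (F ω, X ω, E ω)) (f, x, e) ≤ pr μ (fun ω => (X ω, E ω)) (x, e) :=
    pr_mono μ fun ω h => congrArg Prod.snd h
  rcases (condEnt_eq_zero_iff μ hEm).1 hE e x with h | h
  · rw [hs] at h
    rw [h] at hle ⊢
    rw [zero_div]
    exact le_antisymm hle (pr_nonneg _ _ _)
  · rw [hs] at h
    have hz : μ (X ⁻¹' {x} \ (fun ω => (X ω, E ω)) ⁻¹' {(x, e)}) = 0 := by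
      have hsub : (fun ω => (X ω, E ω)) ⁻¹' {(x, e)} ⊆ X ⁻¹' {x} :=
        fun ω h => congrArg Prod.fst h
      have hle : μ (X ⁻¹' {x}) ≤ μ ((fun ω => (X ω, E ω)) ⁻¹' {(x, e)}) :=
        ((ENNReal.toReal_eq_toReal_iff' (measure_ne_top _ _) (measure_ne_top _ _)).1 h).ge
      exact ae_le_set.1 (ae_eq_of_subset_of_measure_ge hsub hle
        ((hXm.prodMk hEm) (measurableSet_singleton _)).nullMeasurableSet
        (measure_ne_top _ _)).symm.le
    rw [h, ← hFX f x]
    refine congrArg ENNReal.toReal (measure_congr ?_)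
    filter_upwards [measure_eq_zero_iff_ae_notMem.1 hz] with ω hω
    refine propext ⟨fun h => congrArg (fun t : Fin 2 × SX × SE => (t.1, t.2.1)) h, fun h => ?_⟩
    obtain ⟨h1, h2⟩ := Prod.ext_iff.1 h
    have h3 := not_not.1 fun h3 => hω ⟨h2, h3⟩
    exact Prod.ext h1 h3

/-- The joint law of `F` and `E` on the event `(V_S, V̄_S̄) = 0`. -/
lemma measureReal_label_eq_zero (hXm : Measurable X)
    (hw : ∀ᵐ ω ∂μ, W ω = wfun (X ω)) (S Sb : Finset (Fin k))
    (hFXE : ∀ f x e, pr μ (fun ω => (F ω, X ω, E ω)) (f, x, e) =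
      pr μ (fun ω => (X ω, E ω)) (x, e) / 2) (hsplit : Splits μ X E 4) {e : SE}
    (he : 0 < pr μ E e) :
    μ.real {ω | F ω = 0 ∧ E ω = e ∧ label S Sb (F ω) (W ω) = 0} = pr μ E e / 2 ∧
    μ.real {ω | F ω = 1 ∧ E ω = e ∧ label S Sb (F ω) (W ω) = 0} =
      aCount μ k X E wfun S Sb e * pr μ E e / 8 := by
  classical
  have key : ∀ f, μ.real {ω | F ω = f ∧ E ω = e ∧ label S Sb (F ω) (W ω) = 0} =
      ∑ x, if f = 0 ∨ IsSat S Sb (wfun x) then pr μ (fun ω => (X ω, E ω)) (x, e) / 2 else 0 := by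
    intro f
    rw [measureReal_eq_sum_inter μ hXm]
    refine Finset.sum_congr rfl fun x _ => ?_
    split_ifs with hx
    · rw [← hFXE f]
      refine congrArg ENNReal.toReal (measure_congr ?_)
      filter_upwards [hw] with ω hω
      refine propext ⟨fun h => ?_, fun h => ?_⟩
      · exact Prod.ext h.1.1 (Prod.ext h.2 h.1.2.1)
      · have h1 : F ω = f := congrArg Prod.fst h
        have h2 : X ω = x := congrArg (fun t => t.2.1) h
        have h3 : E ω = e := congrArg (fun t => t.2.2) h
        refine ⟨⟨h1, h3, ?_⟩, h2⟩
        rwa [label_eq_zero_iff, hω, h1, h2]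
    · rw [measureReal_def, measure_eq_zero_iff_ae_notMem.2, ENNReal.toReal_zero]
      filter_upwards [hw] with ω hω
      rintro ⟨⟨h1, -, h2⟩, h3⟩
      change X ω = x at h3
      rw [label_eq_zero_iff, hω, h1, h3] at h2
      exact hx h2
  obtain ⟨hval, -⟩ := hsplit.2 e he
  rw [key, key]
  constructor
  · simp only [true_or, if_true]
    rw [← Finset.sum_div, ← pr_eq_sum_left μ hXm E e]
  · have hx : ∀ x, (if (1 : Fin 2) = 0 ∨ IsSat S Sb (wfun x) then
        pr μ (fun ω => (X ω, E ω)) (x, e) / 2 else 0) =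
        if 0 < pr μ (fun ω => (X ω, E ω)) (x, e) ∧ IsSat S Sb (wfun x) then
          pr μ E e / 8 else 0 := by
      intro x
      simp only [one_ne_zero, false_or]
      rcases hval x with h | h
      · simp [h]
      · have : 0 < pr μ E e / (4 : ℕ) := by positivity
        simp only [h, this, true_and]
        congr 1
        push_cast; ring
    rw [Finset.sum_congr rfl fun x _ => hx x, ← Finset.sum_filter, Finset.sum_const,
      nsmul_eq_mul, mul_div_assoc]
    congr 2
    rw [aCount, ← Set.ncard_coe_finset]
    congr 1
    ext x
    rw [Finset.mem_coe, Finset.mem_filter]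
    exact and_iff_right (Finset.mem_univ x)

end Setup

section Coupling

/-- Any finite-valued variable can be realised jointly with a variable that, given the value `z`
of the first one, is uniform on the prescribed nonempty set `A z`. -/
lemma exists_coupling {Ω : Type*} [MeasurableSpace Ω] (μ : Measure Ω) [IsProbabilityMeasure μ]
    {Z : Type*} [Fintype Z] [MeasurableSpace Z] [MeasurableSingletonClass Z] {T : Ω → Z}
    (hT : Measurable T) {m : ℕ} (A : Z → Finset (Fin m)) (hA : ∀ z, (A z).Nonempty) :
    ∃ (P : ProbSpace) (T' : P.carrier → Z) (U : P.carrier → Fin m),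
      Measurable T' ∧ Measurable U ∧ IdentDistrib T T' μ P.μ ∧
      ∀ (D : Set Z) (u : Fin m) (c : ℝ), 0 ≤ c →
        (∀ z ∈ D, (if u ∈ A z then ((A z).card : ℝ)⁻¹ else 0) = c) →
        P.μ.real (T' ⁻¹' D ∩ U ⁻¹' {u}) = c * μ.real (T ⁻¹' D) := by
  classical
  let eqv := Fintype.equivFin Z
  let ν : Measure (Fin (Fintype.card Z)) := μ.map (eqv ∘ T)
  have hm : Measurable (eqv ∘ T) := (Measurable.of_discrete (f := eqv)).comp hT
  have : IsProbabilityMeasure ν := Measure.isProbabilityMeasure_map hm.aemeasurable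
  let κ : Kernel (Fin (Fintype.card Z)) (Fin m) :=
    ⟨fun i => uniformOn (A (eqv.symm i) : Set (Fin m)), Measurable.of_discrete⟩
  have : IsMarkovKernel κ :=
    ⟨fun i => isProbabilityMeasure_uniformOn (Finset.finite_toSet _) (hA _)⟩
  have hT' : Measurable fun p : Fin (Fintype.card Z) × Fin m => eqv.symm p.1 :=
    (Measurable.of_discrete (f := eqv.symm)).comp measurable_fst
  refine ⟨⟨Fin (Fintype.card Z) × Fin m, ν ⊗ₘ κ⟩, fun p => eqv.symm p.1, fun p => p.2,
    hT', measurable_snd, ⟨hT.aemeasurable, hT'.aemeasurable, ?_⟩, ?_⟩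
  · change _ = Measure.map (eqv.symm ∘ Prod.fst) _
    rw [← Measure.map_map Measurable.of_discrete measurable_fst, ← Measure.fst,
      Measure.fst_compProd, Measure.map_map Measurable.of_discrete hm, ← Function.comp_assoc,
      Equiv.symm_comp_self, Function.id_comp]
  · intro D u c hc hD
    have hset : (fun p : Fin (Fintype.card Z) × Fin m => eqv.symm p.1) ⁻¹' D ∩
        (fun p => p.2) ⁻¹' {u} = (eqv.symm ⁻¹' D) ×ˢ {u} := rfl
    have hκ : ∀ i ∈ eqv.symm ⁻¹' D, κ i {u} = ENNReal.ofReal c := by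
      intro i hi
      rw [← hD _ hi]
      change uniformOn (A (eqv.symm i) : Set (Fin m)) {u} = _
      rw [← Finset.coe_singleton, uniformOn_apply_finset]
      have hpos : (0 : ℝ) < (A (eqv.symm i)).card := by exact_mod_cast (hA _).card_pos
      split_ifs with h
      · rw [Finset.inter_singleton_of_mem h, ENNReal.ofReal_inv_of_pos hpos]
        simp
      · rw [Finset.inter_singleton_of_notMem h]
        simp
    change ((ν ⊗ₘ κ) _).toReal = _
    rw [hset, Measure.compProd_apply_prod MeasurableSet.of_discrete MeasurableSet.of_discrete,
      setLIntegral_congr_fun MeasurableSet.of_discrete hκ, setLIntegral_const, ENNReal.toReal_mul,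
      ENNReal.toReal_ofReal hc, Measure.map_apply hm MeasurableSet.of_discrete]
    congr 3
    ext ω
    simp

end Coupling

section Main

lemma UniformOn.pr_eq {Ω : Type*} [MeasurableSpace Ω] {μ : Measure Ω} [IsProbabilityMeasure μ]
    {A : Type*} [Fintype A] [MeasurableSpace A] [MeasurableSingletonClass A] {U : Ω → A}
    (hU : Measurable U) {n : ℕ} (h : UniformOn μ U n) (u : A) :
    pr μ U u = 0 ∨ pr μ U u = 1 / n := by
  classical
  rcases (pr_nonneg μ U u).eq_or_lt with h0 | h0
  · exact Or.inl h0.symm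
  right
  have hval : ∀ x, pr μ U x = if 0 < pr μ U x then pr μ U u else 0 := fun x => by
    split_ifs with hx
    · exact h.1 x hx u h0
    · exact le_antisymm (not_lt.1 hx) (pr_nonneg _ _ _)
  have hs := sum_pr μ hU
  rw [Finset.sum_congr rfl fun x _ => hval x, ← Finset.sum_filter, Finset.sum_const,
    nsmul_eq_mul] at hs
  have hn : (Finset.univ.filter fun x => 0 < pr μ U x).card = n := by
    rw [← h.2, ← Set.ncard_coe_finset]
    congr 1
    ext x
    rw [Finset.mem_coe, Finset.mem_filter]
    exact and_iff_right (Finset.mem_univ x)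
  rw [hn] at hs
  exact eq_one_div_of_mul_eq_one_right hs

/-- The two blocks `{i < N}` and `{i ≥ N}` of `Fin 105`, indexed by the coin. -/
def block (N : ℕ) (f : Fin 2) : Finset (Fin 105) :=
  Finset.univ.filter fun i => if f = 0 then i.1 < N else N ≤ i.1

lemma mem_block_zero {N : ℕ} {u : Fin 105} : u ∈ block N 0 ↔ u.1 < N := by simp [block]

lemma mem_block_one {N : ℕ} {u : Fin 105} : u ∈ block N 1 ↔ N ≤ u.1 := by simp [block]

lemma card_block_zero {a : ℕ} (ha : a ≤ 3) : (block (420 / (4 + a)) 0).card * (4 + a) = 420 := by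
  interval_cases a <;> rfl

lemma card_block_one {a : ℕ} (ha : a ≤ 3) :
    (block (420 / (4 + a)) 1).card * (4 + a) = 105 * a := by
  interval_cases a <;> rfl

lemma aCount_le_of_splits {k : ℕ} {Ω : Type*} [MeasurableSpace Ω] {μ : Measure Ω} {SX SE : Type*}
    [Fintype SX] [Fintype SE] {X : Ω → SX} {E : Ω → SE} (wfun : SX → (Fin k → Fin 2))
    (S Sb : Finset (Fin k)) {l : ℕ}
    (hsplit : Splits μ X E l) {e : SE} (he : 0 < pr μ E e) :
    aCount μ k X E wfun S Sb e ≤ l := by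
  rw [← (hsplit.2 e he).2]
  exact Set.ncard_le_ncard (fun x hx => hx.1) (Set.toFinite _)

variable {k : ℕ} {Ω : Type*} [MeasurableSpace Ω] {μ : Measure Ω} [IsProbabilityMeasure μ]
  {F : Ω → Fin 2} {W : Ω → (Fin k → Fin 2)}
  {SX SE : Type*} [Fintype SX] [Fintype SE]
  [MeasurableSpace SX] [MeasurableSingletonClass SX]
  [MeasurableSpace SE] [MeasurableSingletonClass SE]
  {X : Ω → SX} {E : Ω → SE}

/-- No adjoined variable exists when the two values of `F` are equally likely given `E = e` and
`(V_S, V̄_S̄) = 0`, and the latter is certain given `E = e`. -/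
lemma false_of_half_split {Ω' : Type*} [MeasurableSpace Ω'] {ν : Measure Ω'}
    [IsProbabilityMeasure ν] {F' : Ω' → Fin 2} {W' : Ω' → (Fin k → Fin 2)} {E' : Ω' → SE}
    {B : Type*} [Fintype B] [MeasurableSpace B] [MeasurableSingletonClass B] {U : Ω' → B}
    (hF : Measurable F') (hW : Measurable W') (hE : Measurable E') (hU : Measurable U)
    (S Sb : Finset (Fin k)) {e : SE} {c : ℝ} (hc : 0 < c)
    (hhalf : ∀ f, ν.real {ω | F' ω = f ∧ E' ω = e ∧ label S Sb (F' ω) (W' ω) = 0} = c)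
    (hunif : UniformOn ν U 105)
    (hmi : mi ν U (fun ω => (E' ω, (fun i : S => (1 - W' ω i.1) * F' ω),
        (fun i : Sb => W' ω i.1 * F' ω))) = 0)
    (hce : condEnt ν F' (fun ω => ((fun i : S => (1 - W' ω i.1) * F' ω),
        (fun i : Sb => W' ω i.1 * F' ω), E' ω, U ω)) = 0) : False := by
  classical
  have hmY : Measurable (fun ω => (E' ω, (fun i : S => (1 - W' ω i.1) * F' ω),
      (fun i : Sb => W' ω i.1 * F' ω))) :=
    (Measurable.of_discrete (f := fun p : SE × Fin 2 × (Fin k → Fin 2) =>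
      (p.1, label S Sb p.2.1 p.2.2))).comp (hE.prodMk (hF.prodMk hW))
  have hY : pr ν (fun ω => (E' ω, (fun i : S => (1 - W' ω i.1) * F' ω),
      (fun i : Sb => W' ω i.1 * F' ω))) (e, 0, 0) = 2 * c := by
    rw [pr_eq_sum_left ν hF, Fin.sum_univ_two, two_mul]
    have hset : ∀ f, pr ν (fun ω => (F' ω, E' ω, (fun i : S => (1 - W' ω i.1) * F' ω),
        (fun i : Sb => W' ω i.1 * F' ω))) (f, e, 0, 0) = c := fun f => by
      rw [← hhalf f, pr, measureReal_def]
      congr 2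
      ext ω
      simp [label, Prod.ext_iff]
    rw [hset, hset]
  set α : B → ℝ := fun u => pr ν (fun ω => (F' ω, ((fun i : S => (1 - W' ω i.1) * F' ω),
        (fun i : Sb => W' ω i.1 * F' ω), E' ω, U ω))) (0, (0, 0, e, u)) with hα
  have hval : ∀ u, α u = 0 ∨ α u = 2 * c / 105 := by
    intro u
    have hβ : pr ν (fun ω => ((fun i : S => (1 - W' ω i.1) * F' ω),
        (fun i : Sb => W' ω i.1 * F' ω), E' ω, U ω)) (0, 0, e, u) = pr ν U u * (2 * c) := by
      rw [← hY, ← (mi_eq_zero_iff ν hU hmY).1 hmi u (e, 0, 0)]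
      simp only [pr]
      congr 2
      ext ω
      simp only [Set.mem_preimage, Set.mem_singleton_iff, Prod.mk.injEq]
      tauto
    rcases (condEnt_eq_zero_iff ν hF).1 hce 0 (0, 0, e, u) with h | h
    · exact Or.inl h
    · rw [hβ] at h
      rcases hunif.pr_eq hU u with h1 | h1
      · left; rw [hα]; simp only [h, h1, zero_mul]
      · right; rw [hα]; simp only [h, h1]; push_cast; ring
  have hsum : ∑ u, α u = c := by
    rw [← hhalf 0, measureReal_eq_sum_inter ν hU]
    refine Finset.sum_congr rfl fun u _ => ?_
    simp only [hα, pr, measureReal_def]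
    congr 2
    ext ω
    simp only [Set.mem_preimage, Set.mem_singleton_iff, Set.mem_inter_iff,
      Set.mem_ofPred_eq, label, Prod.ext_iff, Prod.fst_zero, Prod.snd_zero]
    tauto
  have hval' : ∀ u, α u = if α u ≠ 0 then 2 * c / 105 else 0 := fun u => by
    rcases hval u with h | h
    · simp [h]
    · simp only [h]
      rw [if_pos (by positivity)]
  rw [Finset.sum_congr rfl fun u _ => hval' u, ← Finset.sum_filter, Finset.sum_const,
    nsmul_eq_mul] at hsum
  set n := (Finset.univ.filter fun u => α u ≠ 0).card
  have h2 : (n : ℝ) * 2 = 105 := by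
    have : ((n : ℝ) * 2 - 105) * c = 0 := by linear_combination 105 * hsum
    rcases mul_eq_zero.1 this with h | h
    · linarith
    · exact absurd h hc.ne'
  have h3 : n * 2 = 105 := by exact_mod_cast h2
  omega

/-- The adjoined variable exists when at most three labels in each fibre satisfy the predicate. -/
lemma exists_uniform_of_le_three (hFm : Measurable F) (hWm : Measurable W) (hXm : Measurable X)
    (hEm : Measurable E) (S Sb : Finset (Fin k)) (a : SE → ℕ)
    (ha : ∀ e, 0 < pr μ E e → a e ≤ 3)
    (hlaw : ∀ e, 0 < pr μ E e →
      μ.real {ω | F ω = 0 ∧ E ω = e ∧ label S Sb (F ω) (W ω) = 0} = pr μ E e / 2 ∧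
      μ.real {ω | F ω = 1 ∧ E ω = e ∧ label S Sb (F ω) (W ω) = 0} = a e * pr μ E e / 8) :
    ∃ (P : ProbSpace) (F' : P.carrier → Fin 2) (W' : P.carrier → (Fin k → Fin 2))
      (X' : P.carrier → SX) (E' : P.carrier → SE)
      (TU : FinAlphabet) (U : P.carrier → TU.carrier),
      Measurable F' ∧ Measurable W' ∧ Measurable X' ∧ Measurable E' ∧ Measurable U ∧
      IdentDistrib (fun ω => (F ω, W ω, X ω, E ω))
        (fun ω => (F' ω, W' ω, X' ω, E' ω)) μ P.μ ∧
      UniformOn P.μ U 105 ∧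
      mi P.μ U (fun ω => (E' ω, (fun i : S => (1 - W' ω i.1) * F' ω),
        (fun i : Sb => W' ω i.1 * F' ω))) = 0 ∧
      condEnt P.μ F' (fun ω => ((fun i : S => (1 - W' ω i.1) * F' ω),
        (fun i : Sb => W' ω i.1 * F' ω), E' ω, U ω)) = 0 := by
  classical
  let N : SE → ℕ := fun e => 420 / (4 + a e)
  let A : Fin 2 × (Fin k → Fin 2) × SX × SE → Finset (Fin 105) := fun z =>
    if label S Sb z.1 z.2.1 = 0 ∧ (block (N z.2.2.2) z.1).Nonempty then block (N z.2.2.2) z.1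
    else Finset.univ
  have hA : ∀ z, (A z).Nonempty := fun z => by
    simp only [A]
    split_ifs with h
    · exact h.2
    · exact Finset.univ_nonempty
  obtain ⟨P, T', U, hT', hU, hid, hlawU⟩ :=
    exists_coupling μ (hFm.prodMk (hWm.prodMk (hXm.prodMk hEm))) A hA
  have hF' : Measurable fun ω => (T' ω).1 := measurable_fst.comp hT'
  have hW' : Measurable fun ω => (T' ω).2.1 := measurable_fst.comp (measurable_snd.comp hT')
  have hX' : Measurable fun ω => (T' ω).2.2.1 :=
    measurable_fst.comp (measurable_snd.comp (measurable_snd.comp hT'))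
  have hE' : Measurable fun ω => (T' ω).2.2.2 :=
    measurable_snd.comp (measurable_snd.comp (measurable_snd.comp hT'))
  have hid' : ∀ D, P.μ.real (T' ⁻¹' D) = μ.real ((fun ω => (F ω, W ω, X ω, E ω)) ⁻¹' D) :=
    fun D => congrArg ENNReal.toReal (hid.measure_mem_eq (MeasurableSet.of_discrete (s := D))).symm
  have hpE : ∀ e, pr P.μ (fun ω => (T' ω).2.2.2) e = pr μ E e := fun e =>
    hid' {z | z.2.2.2 = e}
  -- the law of `U` on the event where the label vanishes
  have hblock : ∀ e, 0 < pr μ E e → ∀ u : Fin 105,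
      P.μ.real (T' ⁻¹' {z | z.1 = 0 ∧ z.2.2.2 = e ∧ label S Sb z.1 z.2.1 = 0} ∩ U ⁻¹' {u}) =
        (if u.1 < N e then (4 + a e) * pr μ E e / 840 else 0) ∧
      P.μ.real (T' ⁻¹' {z | z.1 = 1 ∧ z.2.2.2 = e ∧ label S Sb z.1 z.2.1 = 0} ∩ U ⁻¹' {u}) =
        (if u.1 < N e then 0 else (4 + a e) * pr μ E e / 840) := by
    intro e he u
    obtain ⟨h0, h1⟩ := hlaw e he
    have c0 := card_block_zero (ha e he)
    have c1 := card_block_one (ha e he)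
    have c0' : ((block (N e) 0).card : ℝ) * (4 + a e) = 420 := by exact_mod_cast c0
    have c1' : ((block (N e) 1).card : ℝ) * (4 + a e) = 105 * a e := by exact_mod_cast c1
    have hpos : (0 : ℝ) < 4 + a e := by positivity
    constructor
    · have hne : (block (N e) 0).Nonempty := Finset.card_pos.1 (by
        rcases Nat.eq_zero_or_pos (block (N e) 0).card with h | h
        · simp only [N] at h; rw [h] at c0; omega
        · exact h)
      have hc := Nat.cast_pos (α := ℝ).2 hne.card_pos
      rw [hlawU _ u (if u.1 < N e then ((block (N e) 0).card : ℝ)⁻¹ else 0)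
        (by split_ifs <;> positivity)]
      · change _ * μ.real {ω | F ω = 0 ∧ E ω = e ∧ label S Sb (F ω) (W ω) = 0} = _
        rw [h0]
        split_ifs
        · field_simp
          linear_combination (-2) * c0'
        · simp
      · rintro z ⟨hz1, hz2, hz3⟩
        have : A z = block (N e) 0 := by
          simp only [A]
          rw [if_pos ⟨hz3, by rwa [hz1, hz2]⟩, hz1, hz2]
        simp only [this, mem_block_zero]
    · rcases Nat.eq_zero_or_pos (a e) with h | h
      · have hN : N e = 105 := by simp [N, h]
        rw [if_pos (show u.1 < N e by omega)]
        refine le_antisymm ?_ measureReal_nonneg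
        refine (measureReal_mono Set.inter_subset_left).trans ?_
        rw [hid']
        refine h1.le.trans ?_
        simp [h]
      have hne : (block (N e) 1).Nonempty := Finset.card_pos.1 (by
        rcases Nat.eq_zero_or_pos (block (N e) 1).card with h | h
        · simp only [N] at h; rw [h] at c1; omega
        · exact h)
      have hc := Nat.cast_pos (α := ℝ).2 hne.card_pos
      rw [hlawU _ u (if u.1 < N e then 0 else ((block (N e) 1).card : ℝ)⁻¹)
        (by split_ifs <;> positivity)]
      · change _ * μ.real {ω | F ω = 1 ∧ E ω = e ∧ label S Sb (F ω) (W ω) = 0} = _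
        rw [h1]
        split_ifs
        · simp
        · field_simp
          linear_combination (-8) * c1'
      · rintro z ⟨hz1, hz2, hz3⟩
        have : A z = block (N e) 1 := by
          simp only [A]
          rw [if_pos ⟨hz3, by rwa [hz1, hz2]⟩, hz1, hz2]
        simp only [this, mem_block_one, ← not_lt, ite_not]
  -- joint law of `U` with `E` and the label
  have hjoint : ∀ (u : Fin 105) (e : SE) (y : (S → Fin 2) × (Sb → Fin 2)),
      P.μ.real (T' ⁻¹' {z | z.2.2.2 = e ∧ label S Sb z.1 z.2.1 = y} ∩ U ⁻¹' {u}) =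
        105⁻¹ * P.μ.real (T' ⁻¹' {z | z.2.2.2 = e ∧ label S Sb z.1 z.2.1 = y}) := by
    intro u e y
    rcases (pr_nonneg μ E e).eq_or_lt with he | he
    · have hz : P.μ.real (T' ⁻¹' {z | z.2.2.2 = e ∧ label S Sb z.1 z.2.1 = y}) = 0 := by
        refine le_antisymm ?_ measureReal_nonneg
        rw [he, ← hpE]
        exact measureReal_mono fun ω h => h.1
      rw [hz, mul_zero]
      refine le_antisymm ?_ measureReal_nonneg
      rw [← hz]
      exact measureReal_mono Set.inter_subset_left
    rcases eq_or_ne y 0 with rfl | hy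
    · have hsp : ∀ s, P.μ.real s = P.μ.real (s ∩ T' ⁻¹' {z | z.1 = 0}) +
          P.μ.real (s ∩ T' ⁻¹' {z | z.1 = 1}) := fun s => by
        rw [measureReal_eq_sum_inter P.μ hF' s, Fin.sum_univ_two]
        rfl
      obtain ⟨h0, h1⟩ := hlaw e he
      obtain ⟨b0, b1⟩ := hblock e he u
      have s1 : ∀ f, T' ⁻¹' {z | z.2.2.2 = e ∧ label S Sb z.1 z.2.1 = 0} ∩ T' ⁻¹' {z | z.1 = f} =
          T' ⁻¹' {z | z.1 = f ∧ z.2.2.2 = e ∧ label S Sb z.1 z.2.1 = 0} := fun f => by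
        ext ω; simp [and_comm]
      have s2 : ∀ f, T' ⁻¹' {z | z.2.2.2 = e ∧ label S Sb z.1 z.2.1 = 0} ∩ U ⁻¹' {u} ∩
          T' ⁻¹' {z | z.1 = f} =
          T' ⁻¹' {z | z.1 = f ∧ z.2.2.2 = e ∧ label S Sb z.1 z.2.1 = 0} ∩ U ⁻¹' {u} := fun f => by
        rw [Set.inter_right_comm, s1]
      have t0 := (hid' {z | z.1 = 0 ∧ z.2.2.2 = e ∧ label S Sb z.1 z.2.1 = 0}).trans h0
      have t1 := (hid' {z | z.1 = 1 ∧ z.2.2.2 = e ∧ label S Sb z.1 z.2.1 = 0}).trans h1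
      rw [hsp, s2, s2, b0, b1, hsp (T' ⁻¹' {z | z.2.2.2 = e ∧ label S Sb z.1 z.2.1 = 0}), s1, s1,
        t0, t1]
      split_ifs <;> ring
    · rw [hlawU _ u 105⁻¹ (by norm_num), hid']
      rintro z ⟨-, hz⟩
      have : A z = Finset.univ := if_neg fun h => hy (hz ▸ h.1)
      simp [this]
  have hmY : Measurable (fun ω => ((T' ω).2.2.2, (fun i : S => (1 - (T' ω).2.1 i.1) * (T' ω).1),
      (fun i : Sb => (T' ω).2.1 i.1 * (T' ω).1))) :=
    (Measurable.of_discrete (f := fun p : Fin 2 × (Fin k → Fin 2) × SX × SE =>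
      (p.2.2.2, label S Sb p.1 p.2.1))).comp hT'
  have hjoint' : ∀ u t, pr P.μ (fun ω => (U ω, ((T' ω).2.2.2,
      (fun i : S => (1 - (T' ω).2.1 i.1) * (T' ω).1),
      (fun i : Sb => (T' ω).2.1 i.1 * (T' ω).1)))) (u, t) =
      105⁻¹ * pr P.μ (fun ω => ((T' ω).2.2.2, (fun i : S => (1 - (T' ω).2.1 i.1) * (T' ω).1),
      (fun i : Sb => (T' ω).2.1 i.1 * (T' ω).1))) t := by
    rintro u ⟨e, y⟩
    have hs : (fun ω => ((T' ω).2.2.2, (fun i : S => (1 - (T' ω).2.1 i.1) * (T' ω).1),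
        (fun i : Sb => (T' ω).2.1 i.1 * (T' ω).1))) ⁻¹' {(e, y)} =
        T' ⁻¹' {z | z.2.2.2 = e ∧ label S Sb z.1 z.2.1 = y} := by
      ext ω; simp [label]
    have h := hjoint u e y
    rw [← hs] at h
    rw [pr, pr, ← measureReal_def, ← measureReal_def, ← h]
    congr 1
    ext ω
    simp [and_comm]
  have hprU : ∀ u, pr P.μ U u = 105⁻¹ := fun u => by
    rw [pr_eq_sum_right P.μ U hmY, Finset.sum_congr rfl fun t _ => hjoint' u t, ← Finset.mul_sum,
      sum_pr P.μ hmY, mul_one]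
  refine ⟨P, fun ω => (T' ω).1, fun ω => (T' ω).2.1, fun ω => (T' ω).2.2.1,
    fun ω => (T' ω).2.2.2, ⟨Fin 105⟩, U, hF', hW', hX', hE', hU, hid, ⟨?_, ?_⟩, ?_, ?_⟩
  · intro x _ y _
    rw [hprU, hprU]
  · have : support P.μ U = Set.univ := Set.eq_univ_of_forall fun u => by
      change 0 < pr P.μ U u
      rw [hprU]; norm_num
    rw [this, Set.ncard_univ, Nat.card_eq_fintype_card]
    exact Fintype.card_fin 105
  · rw [mi_eq_zero_iff P.μ hU hmY]
    intro u t
    rw [hprU]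
    exact hjoint' u t
  · refine condEnt_eq_zero_of_forall_exists P.μ hF' ?_
    rintro ⟨y1, y2, e, u⟩
    have hzero : ∀ (f : Fin 2) (D : Set P.carrier), P.μ.real D = 0 →
        (∀ ω, (T' ω).1 = f → label S Sb (T' ω).1 (T' ω).2.1 = (y1, y2) → (T' ω).2.2.2 = e →
          U ω = u → ω ∈ D) →
        pr P.μ (fun ω => ((T' ω).1, ((fun i : S => (1 - (T' ω).2.1 i.1) * (T' ω).1),
          (fun i : Sb => (T' ω).2.1 i.1 * (T' ω).1), (T' ω).2.2.2, U ω))) (f, (y1, y2, e, u)) =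
          0 := by
      intro f D hD h
      refine le_antisymm ?_ (pr_nonneg _ _ _)
      rw [← hD]
      refine measureReal_mono fun ω hω => ?_
      simp only [Set.mem_preimage, Set.mem_singleton_iff, Prod.mk.injEq] at hω
      obtain ⟨h1, h2, h3, h4, h5⟩ := hω
      exact h ω h1 (Prod.ext h2 h3) h4 h5
    rcases (pr_nonneg μ E e).eq_or_lt with he | he
    · exact ⟨0, fun f _ => hzero f _ ((hpE e).trans he.symm) fun ω _ _ h _ => h⟩
    by_cases hy : (y1, y2) = (0 : (S → Fin 2) × (Sb → Fin 2))
    · obtain ⟨b0, b1⟩ := hblock e he u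
      by_cases hu : u.1 < N e
      · rw [if_pos hu] at b1
        refine ⟨0, fun f hf => ?_⟩
        obtain rfl : f = 1 := by omega
        exact hzero 1 _ b1 fun ω h1 h2 h3 h4 => ⟨⟨h1, h3, h2.trans hy⟩, h4⟩
      · rw [if_neg hu] at b0
        refine ⟨1, fun f hf => ?_⟩
        obtain rfl : f = 0 := by omega
        exact hzero 0 _ b0 fun ω h1 h2 h3 h4 => ⟨⟨h1, h3, h2.trans hy⟩, h4⟩
    · refine ⟨1, fun f hf => ?_⟩
      obtain rfl : f = 0 := by omega
      refine hzero 0 ∅ measureReal_empty fun ω h1 h2 _ _ => hy ?_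
      rw [← h2, label_eq_zero_iff]
      exact Or.inl h1

end Main

/-- in the COLD setup with E splitting X into sets of size 4, a uniform
105-valued U with I(U;(E,V_S,V̄_S̄)) = 0 and H(F|V_S,V̄_S̄,E,U) = 0 can be adjoined iff
aCount μ k X E wfun S Sb e ≤ 3 holds for every e of positive probability. -/
theorem stmt_11 {Ω : Type*} [MeasurableSpace Ω] (μ : Measure Ω) [IsProbabilityMeasure μ]
    (k : ℕ) (hk : 1 ≤ k)
    (F : Ω → Fin 2) (W : Ω → (Fin k → Fin 2))
    (hFm : Measurable F) (hWm : Measurable W)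
    (hFunif : ∀ x : Fin 2, pr μ F x = 2⁻¹)
    (hindep : IndepFun F W μ)
    (V Vb : Fin k → Ω → Fin 2)
    (hV : ∀ i ω, V i ω = (1 - W ω i) * F ω)
    (hVb : ∀ i ω, Vb i ω = W ω i * F ω)
    {SX SE : Type*} [Fintype SX] [Fintype SE]
    [MeasurableSpace SX] [MeasurableSingletonClass SX]
    [MeasurableSpace SE] [MeasurableSingletonClass SE]
    (X : Ω → SX) (hXm : Measurable X)
    (wfun : SX → (Fin k → Fin 2)) (hwfun : μ {ω | W ω = wfun (X ω)} = 1)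
    (hcmi : cmi μ (fun ω => ((fun i => V i ω), (fun i => Vb i ω), F ω)) X W = 0)
    (E : Ω → SE) (hEm : Measurable E) (hsplit : Splits μ X E 4)
    (S Sb : Finset (Fin k)) :
    (∃ (P : ProbSpace) (F' : P.carrier → Fin 2) (W' : P.carrier → (Fin k → Fin 2))
      (X' : P.carrier → SX) (E' : P.carrier → SE)
      (TU : FinAlphabet) (U : P.carrier → TU.carrier),
      Measurable F' ∧ Measurable W' ∧ Measurable X' ∧ Measurable E' ∧ Measurable U ∧
      IdentDistrib (fun ω => (F ω, W ω, X ω, E ω))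
        (fun ω => (F' ω, W' ω, X' ω, E' ω)) μ P.μ ∧
      UniformOn P.μ U 105 ∧
      mi P.μ U (fun ω => (E' ω, (fun i : S => (1 - W' ω i.1) * F' ω),
        (fun i : Sb => W' ω i.1 * F' ω))) = 0 ∧
      condEnt P.μ F' (fun ω => ((fun i : S => (1 - W' ω i.1) * F' ω),
        (fun i : Sb => W' ω i.1 * F' ω), E' ω, U ω)) = 0) ↔
    (∀ e : SE, 0 < pr μ E e → aCount μ k X E wfun S Sb e ≤ 3) := by
  have hWX : MeasurableSet {ω | W ω = wfun (X ω)} :=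
    (hWm.prodMk hXm) (MeasurableSet.of_discrete (s := {p : (Fin k → Fin 2) × SX | p.1 = wfun p.2}))
  have hw : ∀ᵐ ω ∂μ, W ω = wfun (X ω) := (mem_ae_iff_prob_eq_one hWX).2 hwfun
  have hFXE := pr_coin_prod_prod hXm hEm
    (pr_coin_prod hFm hWm hXm hFunif hindep hV hVb hw hcmi) hsplit.1
  have hlaw := fun e (he : 0 < pr μ E e) =>
    measureReal_label_eq_zero hXm hw S Sb hFXE hsplit he
  constructor
  · rintro ⟨P, F', W', X', E', TU, U, hF', hW', hX', hE', hU, hid, hunif, hmi, hce⟩ e he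
    by_contra hlt
    have ha : aCount μ k X E wfun S Sb e = 4 :=
      le_antisymm (aCount_le_of_splits wfun S Sb hsplit he) (by omega)
    obtain ⟨h0, h1⟩ := hlaw e he
    refine false_of_half_split (e := e) hF' hW' hE' hU S Sb (half_pos he) (fun f => ?_)
      hunif hmi hce
    have ht : μ.real {ω | F ω = f ∧ E ω = e ∧ label S Sb (F ω) (W ω) = 0} =
        P.μ.real {ω | F' ω = f ∧ E' ω = e ∧ label S Sb (F' ω) (W' ω) = 0} :=
      congrArg ENNReal.toReal (hid.measure_mem_eq (MeasurableSet.of_discrete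
        (s := {z : Fin 2 × (Fin k → Fin 2) × SX × SE |
          z.1 = f ∧ z.2.2.2 = e ∧ label S Sb z.1 z.2.1 = 0})))
    rw [← ht]
    rcases (by decide : ∀ f : Fin 2, f = 0 ∨ f = 1) f with rfl | rfl
    · exact h0
    · rw [h1, ha]
      push_cast
      ring
  · exact fun ha => exists_uniform_of_le_three hFm hWm hXm hEm S Sb _ ha hlaw

end CIPaper
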